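/- arXiv:1607.03728 — 2 statements merged into one kernel-verified Lean document; each statement's English description precedes it below -/
import Mathlib

section
/- Assume $\{\alpha_1'\} \neq 0$. Then $\sum_{\rho=0}^{1}\sum_{\sigma=0}^{1}\sum_{p=0}^{\ell-1} (-1)^{\rho+\sigma}\, \xi^{-2\mu_1'(\mu_2+\sigma+p)-2\mu_2'(\mu_1+\rho-\sigma-2p)-4\mu_2'(\mu_2+\sigma+p)-\ell(\mu_1+\rho-\sigma-2p)-2(\mu_2+\sigma+p)} = \xi^{-4\alpha_2\alpha_2'-2(\alpha_2\alpha_1'+\alpha_1\alpha_2')}\,\dfrac{\{\ell\alpha_1'\}\{\alpha_2'\}\{\alpha_1'+\alpha_2'\}}{\{\alpha_1'\}}$. (This is the value $S'(\mu,\mu')$ of the Reshetikhin--Turaev bracket of the Hopf link with closed component colored by the typical module $V_{\mu}$ and open component colored by the simple module $V_{\mu'}$ of $\mathcal{U}_{\xi}^{H}\mathfrak{sl}(2|1)$; the sum runs over the weight basis $w_{\rho,\sigma,p}$ of $V_{\mu}$.) -/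
open Complex

/-- `ξ^x = exp(2πix/ℓ)`. -/
noncomputable def xi (ℓ : ℕ) (x : ℂ) : ℂ := Complex.exp (2 * (Real.pi : ℂ) * Complex.I * x / (ℓ : ℂ))

/-- `{x} = ξ^x - ξ^{-x}`. -/
noncomputable def br (ℓ : ℕ) (x : ℂ) : ℂ := xi ℓ x - xi ℓ (-x)

theorem xi_add (ℓ : ℕ) (x y : ℂ) : xi ℓ (x + y) = xi ℓ x * xi ℓ y := by
  rw [xi, xi, xi, ← Complex.exp_add]
  congr 1
  ring

theorem xi_mul_xi_neg (ℓ : ℕ) (x : ℂ) : xi ℓ x * xi ℓ (-x) = 1 := by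
  rw [← xi_add, add_neg_cancel]
  simp [xi]

theorem xi_nat_mul (ℓ n : ℕ) (x : ℂ) : xi ℓ (n * x) = xi ℓ x ^ n := by
  rw [xi, xi, ← Complex.exp_nat_mul]
  congr 1
  ring

/-- The symmetric form of the finite geometric sum with ratio `ξ^{-2x}`. -/
theorem geom_sum_mul_br (ℓ n : ℕ) (x : ℂ) :
    (∑ p ∈ Finset.range n, xi ℓ (-2 * x) ^ p) * br ℓ x =
      xi ℓ x * xi ℓ (-(n * x)) * br ℓ (n * x) := by
  have hsq : xi ℓ (-2 * x) = xi ℓ (-x) * xi ℓ (-x) := by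
    rw [← xi_add]
    ring_nf
  have hpow : xi ℓ (-2 * x) ^ n = xi ℓ (-(n * x)) * xi ℓ (-(n * x)) := by
    rw [hsq, mul_pow, ← xi_nat_mul, mul_neg]
  have hgeom := mul_neg_geom_sum (xi ℓ (-2 * x)) n
  rw [hpow] at hgeom
  have hx := xi_mul_xi_neg ℓ x
  have hnx := xi_mul_xi_neg ℓ (n * x)
  have hbr : br ℓ x = xi ℓ x * (1 - xi ℓ (-2 * x)) := by
    rw [br, hsq]
    linear_combination xi ℓ (-x) * hx
  rw [hbr, br]
  linear_combination xi ℓ x * hgeom - xi ℓ x * hnx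

theorem one_sub_xi (ℓ : ℕ) (x : ℂ) : 1 - xi ℓ (-2 * x) = xi ℓ (-x) * br ℓ x := by
  have hsq : xi ℓ (-2 * x) = xi ℓ (-x) * xi ℓ (-x) := by
    rw [← xi_add]
    ring_nf
  rw [hsq, br]
  linear_combination -xi_mul_xi_neg ℓ x

/-- The value `S'(μ,μ')` of the Reshetikhin–Turaev bracket of the Hopf link
colored by `V_μ` (closed component) and `V_{μ'}` (open component):
`∑_{ρ,σ∈{0,1}} ∑_{p=0}^{ℓ-1} (-1)^{ρ+σ}
  ξ^{-2μ₁'(μ₂+σ+p)-2μ₂'(μ₁+ρ-σ-2p)-4μ₂'(μ₂+σ+p)-ℓ(μ₁+ρ-σ-2p)-2(μ₂+σ+p)}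
  = ξ^{-4α₂α₂'-2(α₂α₁'+α₁α₂')} {ℓα₁'}{α₂'}{α₁'+α₂'}/{α₁'}`. -/
theorem hopf_link_bracket_value
    (ℓ : ℕ) (hℓ3 : 3 ≤ ℓ) (hodd : Odd ℓ)
    (μ₁ μ₂ μ₁' μ₂' : ℂ)
    (α₁ α₂ α₁' α₂' : ℂ)
    (hα₁ : α₁ = μ₁ - (ℓ : ℂ) + 1) (hα₂ : α₂ = μ₂ + (ℓ : ℂ) / 2)
    (hα₁' : α₁' = μ₁' - (ℓ : ℂ) + 1) (hα₂' : α₂' = μ₂' + (ℓ : ℂ) / 2)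
    (h0 : br ℓ α₁' ≠ 0) :
    ∑ ρ ∈ Finset.range 2, ∑ σ ∈ Finset.range 2, ∑ p ∈ Finset.range ℓ,
      (-1 : ℂ) ^ (ρ + σ) *
        xi ℓ (-2 * μ₁' * (μ₂ + (σ : ℂ) + (p : ℂ))
          - 2 * μ₂' * (μ₁ + (ρ : ℂ) - (σ : ℂ) - 2 * (p : ℂ))
          - 4 * μ₂' * (μ₂ + (σ : ℂ) + (p : ℂ))
          - (ℓ : ℂ) * (μ₁ + (ρ : ℂ) - (σ : ℂ) - 2 * (p : ℂ))
          - 2 * (μ₂ + (σ : ℂ) + (p : ℂ)))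
      = xi ℓ (-4 * α₂ * α₂' - 2 * (α₂ * α₁' + α₁ * α₂')) *
          (br ℓ ((ℓ : ℂ) * α₁') * br ℓ α₂' * br ℓ (α₁' + α₂')) / br ℓ α₁' := by
  have hterm : ∀ ρ σ p : ℕ,
      xi ℓ (-2 * μ₁' * (μ₂ + (σ : ℂ) + (p : ℂ))
          - 2 * μ₂' * (μ₁ + (ρ : ℂ) - (σ : ℂ) - 2 * (p : ℂ))
          - 4 * μ₂' * (μ₂ + (σ : ℂ) + (p : ℂ))
          - (ℓ : ℂ) * (μ₁ + (ρ : ℂ) - (σ : ℂ) - 2 * (p : ℂ))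
          - 2 * (μ₂ + (σ : ℂ) + (p : ℂ)))
        = xi ℓ (-4 * α₂ * α₂' - 2 * (α₂ * α₁' + α₁ * α₂')) *
            xi ℓ (α₂' + α₂' + ℓ * α₁') *
            xi ℓ (-2 * α₂') ^ ρ * xi ℓ (-2 * (α₁' + α₂')) ^ σ * xi ℓ (-2 * α₁') ^ p := by
    intro ρ σ p
    simp only [← xi_nat_mul, ← xi_add]
    subst hα₁ hα₂ hα₁' hα₂'
    congr 1
    ring
  have hcancel : xi ℓ (α₂' + α₂' + ℓ * α₁') * xi ℓ (-α₂') * xi ℓ (-(α₁' + α₂')) *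
      (xi ℓ α₁' * xi ℓ (-(ℓ * α₁'))) = 1 := by
    simp only [← xi_add]
    ring_nf
    simp [xi]
  simp only [hterm, ← Finset.mul_sum]
  simp only [Finset.sum_range_succ, Finset.sum_range_zero]
  rw [eq_div_iff h0]
  have hgeom := geom_sum_mul_br ℓ ℓ α₁'
  have hρ := one_sub_xi ℓ α₂'
  have hσ := one_sub_xi ℓ (α₁' + α₂')
  generalize ∑ p ∈ Finset.range ℓ, xi ℓ (-2 * α₁') ^ p = S at hgeom ⊢
  generalize xi ℓ (-4 * α₂ * α₂' - 2 * (α₂ * α₁' + α₁ * α₂')) = E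
  generalize xi ℓ (α₂' + α₂' + ℓ * α₁') = F at hcancel ⊢
  calc
    _ = E * F * (1 - xi ℓ (-2 * α₂')) * (1 - xi ℓ (-2 * (α₁' + α₂'))) * (S * br ℓ α₁') := by ring
    _ = _ := by
      rw [hρ, hσ, hgeom]
      linear_combination
        E * br ℓ α₂' * br ℓ (α₁' + α₂') * br ℓ (ℓ * α₁') * hcancel
end

section
/- Assume $2\alpha_2 \notin \mathbb{Z}$ and $2(\alpha_1+\alpha_2) \notin \mathbb{Z}$ (so all denominators below are nonzero). Then $\sum_{s=0}^{\ell-1}\sum_{t=0}^{\ell-1} \dfrac{\{\alpha_1+s\}}{\{\alpha_2+t\}\{\alpha_1+\alpha_2+s+t\}}\,\xi^{2(t^2+st)} = \dfrac{\ell\,\{\alpha_1\}}{\{\alpha_2\}\{\alpha_1+\alpha_2\}}$. (This identity is exactly the statement $\Delta_- = 1$ for the Kirby color $\Omega_{\overline{\mu}}$ in the relative $G$-modular category $\mathscr{C}^H$ of nilpotent weight $\mathcal{U}_{\xi}^{H}\mathfrak{sl}(2|1)$-modules.) -/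
open Complex

theorem xi_neg (ℓ : ℕ) (x : ℂ) : xi ℓ (-x) = (xi ℓ x)⁻¹ := by
  rw [xi, xi, ← Complex.exp_neg]
  congr 1
  ring

theorem xi_ne_zero (ℓ : ℕ) (x : ℂ) : xi ℓ x ≠ 0 := Complex.exp_ne_zero _

theorem xi_mul_natCast (ℓ : ℕ) (x : ℂ) (n : ℕ) : xi ℓ (x * n) = xi ℓ x ^ n := by
  rw [xi, xi, ← Complex.exp_nat_mul]
  congr 1
  ring

theorem isPrimitiveRoot_xi_two {ℓ : ℕ} (hodd : Odd ℓ) : IsPrimitiveRoot (xi ℓ 2) ℓ := by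
  have h := Complex.isPrimitiveRoot_exp_of_coprime 2 ℓ hodd.pos.ne'
    (Nat.coprime_two_left.mpr hodd)
  convert h using 1
  rw [xi]
  congr 1
  push_cast
  ring

theorem xi_two_mul_ne_one {ℓ : ℕ} (hℓ : ℓ ≠ 0) {x : ℂ} (hx : ∀ m : ℤ, 2 * x ≠ m) :
    xi ℓ (2 * x) ≠ 1 := by
  rw [xi, Ne, Complex.exp_eq_one_iff]
  rintro ⟨n, hn⟩
  have hℓ' : (ℓ : ℂ) ≠ 0 := Nat.cast_ne_zero.mpr hℓ
  apply hx (n * ℓ)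
  rw [div_eq_iff hℓ'] at hn
  apply mul_left_cancel₀ Complex.two_pi_I_ne_zero
  push_cast
  linear_combination hn

theorem two_mul_add_natCast_ne_intCast {x : ℂ} (hx : ∀ m : ℤ, 2 * x ≠ m) (n : ℕ) (m : ℤ) :
    2 * (x + n) ≠ m := fun h => hx (m - 2 * n) (by push_cast; linear_combination h)

theorem br_sub_div_br_mul_br {ℓ : ℕ} {x y : ℂ} (hx : xi ℓ (2 * x) ≠ 1) (hy : xi ℓ (2 * y) ≠ 1) :
    br ℓ (y - x) / (br ℓ x * br ℓ y) = (xi ℓ (2 * x) - 1)⁻¹ - (xi ℓ (2 * y) - 1)⁻¹ := by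
  rw [two_mul, xi_add] at hx hy
  have hp := xi_ne_zero ℓ x
  have hq := xi_ne_zero ℓ y
  simp only [br, sub_eq_add_neg y x, neg_add, neg_neg, two_mul, xi_add, xi_neg]
  generalize xi ℓ x = p at *
  generalize xi ℓ y = q at *
  have hx' := sub_ne_zero.mpr hx
  have hy' := sub_ne_zero.mpr hy
  have e₁ : p - p⁻¹ = (p * p - 1) / p := by field_simp
  have e₂ : q - q⁻¹ = (q * q - 1) / q := by field_simp
  rw [e₁, e₂]
  generalize hP : p * p - 1 = P at *
  generalize hQ : q * q - 1 = Q at *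
  field_simp
  rw [← hP, ← hQ]
  ring

theorem Function.Periodic.sum_range_add {M : Type*} [AddCommGroup M] {f : ℕ → M} {n : ℕ}
    (hf : Function.Periodic f n) (k : ℕ) :
    ∑ i ∈ Finset.range n, f (i + k) = ∑ i ∈ Finset.range n, f i := by
  induction k with
  | zero => rfl
  | succ k ih =>
    have h := (Finset.sum_range_succ' (fun i => f (i + k)) n).symm.trans
      (Finset.sum_range_succ (fun i => f (i + k)) n)
    have hk : f (n + k) = f (0 + k) := by rw [zero_add, add_comm, hf]
    rw [hk, add_right_cancel_iff, ih] at h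
    simpa only [add_assoc, add_comm 1 k] using h

theorem IsPrimitiveRoot.sum_sum_mul_pow_mul {R : Type*} [CommRing R] [IsDomain R] {ζ : R} {n : ℕ}
    (hζ : IsPrimitiveRoot ζ n) (hn : 0 < n) (f : ℕ → R) :
    ∑ t ∈ Finset.range n, ∑ s ∈ Finset.range n, f t * ζ ^ (t * s) = n * f 0 := by
  rw [Finset.sum_eq_single_of_mem 0 (Finset.mem_range.mpr hn)]
  · simp
  · intro t ht ht0
    have hne : ζ ^ t - 1 ≠ 0 :=
      sub_ne_zero.mpr (hζ.pow_ne_one_of_pos_of_lt ht0 (Finset.mem_range.mp ht))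
    have h := mul_geom_sum (ζ ^ t) n
    rw [← pow_mul, mul_comm t n, pow_mul, hζ.pow_eq_one, one_pow, sub_self] at h
    simp only [← Finset.mul_sum, pow_mul]
    rw [(mul_eq_zero.mp h).resolve_left hne, mul_zero]

theorem IsPrimitiveRoot.sum_sum_sub_mul_pow {R : Type*} [CommRing R] [IsDomain R] {ζ : R} {n : ℕ}
    (hζ : IsPrimitiveRoot ζ n) (hn : 0 < n) (f : ℕ → R) {g : ℕ → R}
    (hg : Function.Periodic g n) :
    ∑ s ∈ Finset.range n, ∑ t ∈ Finset.range n, (f t - g (s + t)) * ζ ^ (t * (s + t)) =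
      n * (f 0 - g 0) := by
  have hpow (t : ℕ) : Function.Periodic (fun u => ζ ^ (t * u)) n := fun u => by
    simp only [mul_add, pow_add, mul_comm t n, pow_mul, hζ.pow_eq_one, one_pow, mul_one]
  rw [Finset.sum_comm]
  have h (t : ℕ) : ∑ s ∈ Finset.range n, (f t - g (s + t)) * ζ ^ (t * (s + t)) =
      ∑ u ∈ Finset.range n, (f t * ζ ^ (t * u) - g u * ζ ^ (u * t)) := by
    have hper : Function.Periodic (fun u => (f t - g u) * ζ ^ (t * u)) n := fun u => by
      have := hpow t u
      simp only at this ⊢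
      rw [hg, this]
    rw [hper.sum_range_add t]
    exact Finset.sum_congr rfl fun u _ => by rw [sub_mul, mul_comm u t]
  simp only [h, Finset.sum_sub_distrib]
  rw [hζ.sum_sum_mul_pow_mul hn, Finset.sum_comm, hζ.sum_sum_mul_pow_mul hn, mul_sub]

/-- `Δ₋ = 1` for the Kirby color:
`∑_{s,t=0}^{ℓ-1} {α₁+s}/({α₂+t}{α₁+α₂+s+t}) ξ^{2(t²+st)} = ℓ{α₁}/({α₂}{α₁+α₂})`. -/
theorem kirby_color_Delta_minus
    (ℓ : ℕ) (hℓ3 : 3 ≤ ℓ) (hodd : Odd ℓ)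
    (α₁ α₂ : ℂ)
    (h2 : ∀ m : ℤ, 2 * α₂ ≠ (m : ℂ))
    (h12 : ∀ m : ℤ, 2 * (α₁ + α₂) ≠ (m : ℂ)) :
    ∑ s ∈ Finset.range ℓ, ∑ t ∈ Finset.range ℓ,
        br ℓ (α₁ + (s : ℂ)) / (br ℓ (α₂ + (t : ℂ)) * br ℓ (α₁ + α₂ + (s : ℂ) + (t : ℂ)))
          * xi ℓ (2 * ((t : ℂ) ^ 2 + (s : ℂ) * (t : ℂ)))
      = (ℓ : ℂ) * br ℓ α₁ / (br ℓ α₂ * br ℓ (α₁ + α₂)) := by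
  have hℓ : ℓ ≠ 0 := hodd.pos.ne'
  have hζ := isPrimitiveRoot_xi_two hodd
  have hg : Function.Periodic (fun u : ℕ => (xi ℓ (2 * (α₁ + α₂ + u)) - 1)⁻¹) ℓ := fun u => by
    have e : 2 * (α₁ + α₂ + ((u + ℓ : ℕ) : ℂ)) = 2 * (α₁ + α₂ + u) + 2 * ℓ := by
      push_cast
      ring
    simp only [e]
    rw [xi_add, xi_mul_natCast, hζ.pow_eq_one, mul_one]
  have key := hζ.sum_sum_sub_mul_pow hodd.pos (fun t : ℕ => (xi ℓ (2 * (α₂ + t)) - 1)⁻¹) hg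
  simp only [Nat.cast_zero, add_zero] at key
  rw [← br_sub_div_br_mul_br (xi_two_mul_ne_one hℓ h2) (xi_two_mul_ne_one hℓ h12),
    add_sub_cancel_right, ← mul_div_assoc] at key
  rw [← key]
  refine Finset.sum_congr rfl fun s _ => Finset.sum_congr rfl fun t _ => ?_
  rw [← br_sub_div_br_mul_br
    (xi_two_mul_ne_one hℓ (two_mul_add_natCast_ne_intCast h2 t))
    (xi_two_mul_ne_one hℓ (two_mul_add_natCast_ne_intCast h12 (s + t))), ← xi_mul_natCast]
  push_cast
  congr 3 <;> ring_nf
end
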